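/- arXiv:1610.01521 — 3 statements merged into one kernel-verified Lean document; each statement's English description precedes it below -/
import Mathlib

section
/- Let k ≥ 1, let d_1 > d_2 > … > d_k and m_0 > m_1 > … > m_k be positive integers, and let P be a finite poset with |P| = m_0 such that for each 1 ≤ j ≤ k, every subset S of P of cardinality greater than m_j satisfies comp(S) ≥ |S|·d_j. Then there is a collection F of subsets of P such that: (a) |F| ≤ Π_{r=1}^{k} C(m_{r−1}, ≤ ⌊m_{r−1}/(2d_r+1)⌋), where C(n, ≤ j) := Σ_{r=0}^{j} C(n,r) and C(n,r) is the binomial coefficient; (b) every A ∈ F satisfies |A| ≤ m_k + Σ_{r=1}^{k} m_{r−1}/(2d_r+1); and (c) for every antichain I of P there exists A ∈ F with I ⊆ A. -/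
/-- The number of comparable pairs (unordered pairs of distinct comparable elements)
in a finite subset `S` of a poset. -/
noncomputable def compPairs {α : Type*} [PartialOrder α] (S : Finset α) : ℕ :=
  Nat.card {p : α × α // p.1 ∈ S ∧ p.2 ∈ S ∧ p.1 < p.2}

open Classical in
lemma compPairs_eq_sum_card_lt {α : Type*} [PartialOrder α] (S : Finset α) :
    compPairs S = ∑ v ∈ S, (S.filter (v < ·)).card := by
  have h : compPairs S = ((S ×ˢ S).filter fun p => p.1 < p.2).card := by
    rw [compPairs]
    exact Nat.subtype_card _ (by simp [and_assoc])
  rw [h, Finset.card_filter, Finset.sum_product]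
  simp only [Finset.card_filter]

open Classical in
lemma compPairs_eq_sum_card_gt {α : Type*} [PartialOrder α] (S : Finset α) :
    compPairs S = ∑ v ∈ S, (S.filter (· < v)).card := by
  rw [compPairs_eq_sum_card_lt]
  simp only [Finset.card_filter]
  exact Finset.sum_comm

open Classical in
/-- A set with many comparable pairs has an element comparable to many others. -/
lemma exists_two_mul_le_card_comparable {α : Type*} [PartialOrder α] {S : Finset α} {d : ℕ}
    (hS : S.Nonempty) (h : S.card * d ≤ compPairs S) :
    ∃ v ∈ S, 2 * d ≤ (S.filter fun x => v < x ∨ x < v).card := by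
  by_contra! hlt
  have hsum : ∑ v ∈ S, (S.filter fun x => v < x ∨ x < v).card < ∑ _v ∈ S, 2 * d :=
    Finset.sum_lt_sum_of_nonempty hS hlt
  have hdeg : ∀ v ∈ S, (S.filter fun x => v < x ∨ x < v).card =
      (S.filter (v < ·)).card + (S.filter (· < v)).card := by
    intro v _
    rw [Finset.filter_or, Finset.card_union_of_disjoint]
    exact Finset.disjoint_filter.2 fun x _ h₁ h₂ => lt_asymm h₁ h₂
  rw [Finset.sum_congr rfl hdeg, Finset.sum_add_distrib, ← compPairs_eq_sum_card_lt,
    ← compPairs_eq_sum_card_gt, Finset.sum_const, smul_eq_mul] at hsum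
  nlinarith

open Classical in
/-- The Kleitman–Winston algorithm: an antichain `I` in `S` has a small fingerprint `T ⊆ I`
which determines a set `f T` of at most `m` elements containing the rest of `I`. -/
lemma exists_fingerprint {α : Type*} [PartialOrder α] {d m : ℕ}
    (hsat : ∀ S : Finset α, m < S.card → S.card * d ≤ compPairs S) (S : Finset α) :
    ∃ f : Finset α → Finset α, (∀ T, (f T).card ≤ m) ∧
      ∀ I ⊆ S, IsAntichain (· ≤ ·) (I : Set α) →
        ∃ T ⊆ I, T.card * (2 * d + 1) ≤ S.card ∧ I ⊆ T ∪ f T := by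
  induction S using Finset.strongInduction with
  | H S ih =>
    rcases le_or_gt S.card m with hS | hS
    · exact ⟨fun _ => S, fun _ => hS, fun I hI _ => ⟨∅, by simp, by simp, by simpa using hI⟩⟩
    obtain ⟨v, hv, hdeg⟩ := exists_two_mul_le_card_comparable
      (Finset.card_pos.1 (Nat.zero_lt_of_lt hS)) (hsat S hS)
    set N := S.filter fun x => v < x ∨ x < v with hN
    have hvN : v ∉ N := by simp [hN]
    have hNS : insert v N ⊆ S := Finset.insert_subset hv (Finset.filter_subset _ _)
    obtain ⟨f, hf, hfI⟩ := ih (S.erase v) (Finset.erase_ssubset hv)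
    obtain ⟨g, hg, hgI⟩ := ih (S \ insert v N)
      (Finset.sdiff_ssubset hNS (Finset.insert_nonempty v N))
    refine ⟨fun T => if v ∈ T then g (T.erase v) else f T, fun T => ?_, fun I hI hanti => ?_⟩
    · dsimp only
      split_ifs
      exacts [hg _, hf _]
    by_cases hvI : v ∈ I
    · have hsub : I.erase v ⊆ S \ insert v N := by
        intro x hx
        obtain ⟨hxv, hxI⟩ := Finset.mem_erase.1 hx
        simp only [Finset.mem_sdiff, Finset.mem_insert, hN, Finset.mem_filter, not_or, not_and]
        exact ⟨hI hxI, hxv, fun _ =>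
          ⟨fun h => hanti hvI hxI (Ne.symm hxv) h.le, fun h => hanti hxI hvI hxv h.le⟩⟩
      obtain ⟨T, hTI, hTcard, hcov⟩ := hgI _ hsub
        (hanti.subset (Finset.coe_subset.2 (Finset.erase_subset v I)))
      have hvT : v ∉ T := fun h => Finset.notMem_erase v I (hTI h)
      refine ⟨insert v T, Finset.insert_subset hvI (hTI.trans (Finset.erase_subset v I)), ?_, ?_⟩
      · have h₁ := Finset.card_sdiff_add_card_eq_card hNS
        rw [Finset.card_insert_of_notMem hvN] at h₁
        rw [Finset.card_insert_of_notMem hvT]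
        linarith
      · dsimp only
        rw [if_pos (Finset.mem_insert_self v T), Finset.erase_insert hvT, Finset.insert_union]
        exact Finset.subset_insert_iff.2 hcov
    · obtain ⟨T, hTI, hTcard, hcov⟩ := hfI I
        (fun x hx => Finset.mem_erase.2 ⟨fun h => hvI (h ▸ hx), hI hx⟩) hanti
      refine ⟨T, hTI, hTcard.trans (Finset.card_le_card (Finset.erase_subset v S)), ?_⟩
      dsimp only
      rwa [if_neg fun h => hvI (hTI h)]

lemma card_filter_powerset_card_le {α : Type*} (S : Finset α) (n t : ℕ) (hS : S.card ≤ n) :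
    (S.powerset.filter fun T => T.card ≤ t).card ≤ ∑ s ∈ Finset.range (t + 1), n.choose s := by
  classical
  have hsub : (S.powerset.filter fun T => T.card ≤ t) ⊆
      (Finset.range (t + 1)).biUnion fun s => S.powersetCard s := by
    intro T hT
    simp only [Finset.mem_filter, Finset.mem_powerset] at hT
    simp only [Finset.mem_biUnion, Finset.mem_range, Finset.mem_powersetCard]
    exact ⟨T.card, by lia, hT.1, rfl⟩
  refine (Finset.card_le_card hsub).trans (Finset.card_biUnion_le.trans ?_)
  refine Finset.sum_le_sum fun s _ => ?_
  rw [Finset.card_powersetCard]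
  exact Nat.choose_le_choose s hS

open Classical in
/-- After `j` rounds, there are few pairs `(U, S)` consisting of a union of fingerprints and a set
of remaining elements, and every antichain is contained in `U ∪ S` for one of them. -/
lemma exists_container_pairs {α : Type*} [PartialOrder α] [Fintype α] (k : ℕ) (d m : ℕ → ℕ)
    (hm0 : Fintype.card α ≤ m 0)
    (hsat : ∀ j, 1 ≤ j → j ≤ k →
      ∀ S : Finset α, m j < S.card → S.card * d j ≤ compPairs S) :
    ∃ 𝓖 : Finset (Finset α × Finset α),
      𝓖.card ≤ ∏ r ∈ Finset.Icc 1 k,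
        ∑ s ∈ Finset.range (m (r - 1) / (2 * d r + 1) + 1), Nat.choose (m (r - 1)) s ∧
      (∀ p ∈ 𝓖, p.1.card ≤ ∑ r ∈ Finset.Icc 1 k, m (r - 1) / (2 * d r + 1) ∧
        p.2.card ≤ m k) ∧
      ∀ I : Finset α, IsAntichain (· ≤ ·) (I : Set α) → ∃ p ∈ 𝓖, I ⊆ p.1 ∪ p.2 := by
  induction k with
  | zero =>
    refine ⟨{(∅, Finset.univ)}, by simp, by simpa using hm0, fun I _ =>
      ⟨_, Finset.mem_singleton_self _, by simp⟩⟩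
  | succ k ih =>
    obtain ⟨𝓖, hcard, hbound, hcov⟩ := ih fun j h₁ h₂ => hsat j h₁ (h₂.trans k.le_succ)
    choose f hf hfI using exists_fingerprint (hsat (k + 1) k.succ_pos le_rfl)
    set t := m k / (2 * d (k + 1) + 1)
    refine ⟨𝓖.biUnion fun p => (p.2.powerset.filter fun T => T.card ≤ t).image fun T =>
      (p.1 ∪ T, f p.2 T), ?_, ?_, fun I hI => ?_⟩
    · rw [Finset.prod_Icc_succ_top (by lia), Nat.add_sub_cancel]
      refine (Finset.card_biUnion_le_card_mul _ _ _ fun p hp => ?_).trans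
        (Nat.mul_le_mul_right _ hcard)
      exact Finset.card_image_le.trans (card_filter_powerset_card_le _ _ _ (hbound p hp).2)
    · intro q hq
      simp only [Finset.mem_biUnion, Finset.mem_image, Finset.mem_filter] at hq
      obtain ⟨p, hp, T, ⟨-, hT⟩, rfl⟩ := hq
      rw [Finset.sum_Icc_succ_top (by lia), Nat.add_sub_cancel]
      exact ⟨(Finset.card_union_le _ _).trans (Nat.add_le_add (hbound p hp).1 hT), hf _ _⟩
    · obtain ⟨p, hp, hIp⟩ := hcov I hI
      obtain ⟨T, hTI, hTcard, hT⟩ := hfI p.2 (I ∩ p.2) Finset.inter_subset_right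
        (hI.subset (Finset.coe_subset.2 Finset.inter_subset_left))
      refine ⟨(p.1 ∪ T, f p.2 T), ?_, fun x hx => ?_⟩
      · simp only [Finset.mem_biUnion, Finset.mem_image, Finset.mem_filter, Finset.mem_powerset]
        refine ⟨p, hp, T, ⟨hTI.trans Finset.inter_subset_right, ?_⟩, rfl⟩
        exact (Nat.le_div_iff_mul_le (Nat.succ_pos _)).2 (hTcard.trans (hbound p hp).2)
      · rw [Finset.union_assoc]
        rcases Finset.mem_union.1 (hIp hx) with h | h
        · exact Finset.mem_union_left _ h
        · exact Finset.mem_union_right _ (hT (Finset.mem_inter.2 ⟨hx, h⟩))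

/-- Container collection for antichains in a finite poset.  The parameters
`d 1 > d 2 > ⋯ > d k` and `m 0 > m 1 > ⋯ > m k` are positive integers (the values of
`d`, `m` outside these index ranges are irrelevant). -/
theorem containerCollection {α : Type*} [PartialOrder α] [Fintype α] [DecidableEq α]
    (k : ℕ) (hk : 1 ≤ k) (d m : ℕ → ℕ)
    (hdpos : ∀ j, 1 ≤ j → j ≤ k → 0 < d j)
    (hddec : ∀ j, 1 ≤ j → j < k → d (j + 1) < d j)
    (hmpos : ∀ j, j ≤ k → 0 < m j)
    (hmdec : ∀ j, j < k → m (j + 1) < m j)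
    (hm0 : m 0 = Fintype.card α)
    (hsat : ∀ j, 1 ≤ j → j ≤ k →
      ∀ S : Finset α, m j < S.card → S.card * d j ≤ compPairs S) :
    ∃ 𝓕 : Finset (Finset α),
      𝓕.card ≤ ∏ r ∈ Finset.Icc 1 k,
        ∑ s ∈ Finset.range (m (r - 1) / (2 * d r + 1) + 1), Nat.choose (m (r - 1)) s ∧
      (∀ A ∈ 𝓕, (A.card : ℝ) ≤ (m k : ℝ) +
        ∑ r ∈ Finset.Icc 1 k, (m (r - 1) : ℝ) / (2 * d r + 1)) ∧
      ∀ I : Finset α, IsAntichain (· ≤ ·) (I : Set α) → ∃ A ∈ 𝓕, I ⊆ A := by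
  classical
  obtain ⟨𝓖, hcard, hbound, hcov⟩ := exists_container_pairs k d m hm0.ge hsat
  refine ⟨𝓖.image fun p => p.1 ∪ p.2, Finset.card_image_le.trans hcard, fun A hA => ?_,
    fun I hI => ?_⟩
  · obtain ⟨p, hp, rfl⟩ := Finset.mem_image.1 hA
    have hsum : ((∑ r ∈ Finset.Icc 1 k, m (r - 1) / (2 * d r + 1) : ℕ) : ℝ) ≤
        ∑ r ∈ Finset.Icc 1 k, (m (r - 1) : ℝ) / (2 * d r + 1) := by
      rw [Nat.cast_sum]
      refine Finset.sum_le_sum fun r _ => ?_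
      simpa using Nat.cast_div_le (α := ℝ) (m := m (r - 1)) (n := 2 * d r + 1)
    have h₁ : ((p.1 ∪ p.2).card : ℝ) ≤ p.1.card + p.2.card := by
      exact_mod_cast Finset.card_union_le p.1 p.2
    have h₂ : (p.1.card : ℝ) ≤ (∑ r ∈ Finset.Icc 1 k, m (r - 1) / (2 * d r + 1) : ℕ) :=
      Nat.cast_le.2 (hbound p hp).1
    have h₃ : (p.2.card : ℝ) ≤ m k := Nat.cast_le.2 (hbound p hp).2
    linarith
  · obtain ⟨p, hp, hIp⟩ := hcov I hI
    exact ⟨p.1 ∪ p.2, Finset.mem_image_of_mem _ hp, by convert hIp⟩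
end

section
/- For all integers n ≥ 4 and 1 ≤ i ≤ n−3, we have (n+1)/(i+1) ≤ ℓ_{i+1}(n)/ℓ_i(n) ≤ (⌈i/2⌉ − ⌊i/2⌋)/⌈i/2⌉ + (n − ⌈i/2⌉)/⌈(i+2)/2⌉, where both bounds are rational numbers. -/
/-- `ℓ_i(n)`: the number of elements of `{0,1,2}^n` whose coordinates sum to `i`. -/
noncomputable def ell (n i : ℕ) : ℕ :=
  Nat.card {x : Fin n → Fin 3 // ∑ j, (x j : ℕ) = i}

section

open Finset Polynomial

/-- The number of points of `{0,1,2}^n` of rank `i` with exactly `k` coordinates equal to `2`. -/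
def rankTwos (n i k : ℕ) : ℕ :=
  if 2 * k ≤ i then n.choose k * (n - k).choose (i - 2 * k) else 0

theorem ell_eq_coeff (n i : ℕ) : ell n i = ((X ^ 2 + (X + 1) : ℕ[X]) ^ n).coeff i := by
  have h : (X ^ 2 + (X + 1) : ℕ[X]) = ∑ a : Fin 3, X ^ (a : ℕ) := by
    simp [Fin.sum_univ_three]; ring
  have h2 : (∑ a : Fin 3, (X : ℕ[X]) ^ (a : ℕ)) ^ n
      = ∑ x : Fin n → Fin 3, X ^ (∑ j, (x j : ℕ)) := by
    have := Finset.prod_univ_sum (fun _ : Fin n => (univ : Finset (Fin 3)))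
      (fun _ a => (X : ℕ[X]) ^ (a : ℕ))
    simpa [Finset.prod_pow_eq_pow_sum] using this
  rw [h, h2, finsetSum_coeff, ell, Nat.card_eq_fintype_card, Fintype.card_subtype,
    Finset.card_filter]
  simp only [coeff_X_pow, eq_comm]

theorem ell_eq_sum (n i : ℕ) : ell n i = ∑ k ∈ range (n + 1), rankTwos n i k := by
  rw [ell_eq_coeff, add_pow, finsetSum_coeff]
  refine Finset.sum_congr rfl fun k _ => ?_
  rw [← pow_mul, mul_assoc, coeff_X_pow_mul', rankTwos]
  split_ifs with h
  · rw [coeff_mul_natCast, coeff_X_add_one_pow, mul_comm]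
    simp
  · rfl

theorem rankTwos_raise_zero {n i : ℕ} (hi : i ≤ n) (k : ℕ) :
    ((i : ℚ) + 1 - 2 * k) * rankTwos n (i + 1) k = ((n : ℚ) - i + k) * rankTwos n i k := by
  unfold rankTwos
  by_cases h : 2 * k ≤ i
  · obtain ⟨j, rfl⟩ := Nat.exists_eq_add_of_le h
    obtain ⟨z, rfl⟩ := Nat.exists_eq_add_of_le (show k + j ≤ n by omega)
    rw [if_pos h, if_pos (by omega), show 2 * k + j + 1 - 2 * k = j + 1 by omega,
      show 2 * k + j - 2 * k = j by omega, show k + j + z - k = j + z by omega]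
    have := Nat.choose_succ_right_eq (j + z) j
    rw [Nat.add_sub_cancel_left] at this
    have h' : (((j + z).choose (j + 1) : ℕ) : ℚ) * (j + 1) = ((j + z).choose j : ℕ) * z := by
      exact_mod_cast this
    push_cast
    linear_combination (((k + j + z).choose k : ℕ) : ℚ) * h'
  · rw [if_neg h]
    split_ifs with h1
    · have : ((i : ℚ) + 1 - 2 * k) = 0 := by
        have : i + 1 = 2 * k := by omega
        have : ((i : ℚ) + 1) = 2 * k := by exact_mod_cast this
        linarith
      simp [this]
    · simp

theorem rankTwos_raise_one (n i k : ℕ) :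
    ((k : ℚ) + 1) * rankTwos n (i + 1) (k + 1) = ((i : ℚ) - 2 * k) * rankTwos n i k := by
  unfold rankTwos
  by_cases h : 2 * k ≤ i
  · obtain ⟨j, rfl⟩ := Nat.exists_eq_add_of_le h
    rw [if_pos h, show 2 * k + j - 2 * k = j by omega]
    rcases j with _ | j
    · rw [if_neg (by omega)]
      simp
    · rw [if_pos (by omega), show 2 * k + (j + 1) + 1 - 2 * (k + 1) = j by omega]
      have h1 := Nat.choose_succ_right_eq n k
      rcases Nat.lt_or_ge k n with hk | hk
      · obtain ⟨z, rfl⟩ := Nat.exists_eq_add_of_lt hk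
        rw [show k + z + 1 - (k + 1) = z by omega, show k + z + 1 - k = z + 1 by omega]
        rw [show k + z + 1 - k = z + 1 by omega] at h1
        have h2 := Nat.add_one_mul_choose_eq z j
        have h1' : (((k + z + 1).choose (k + 1) : ℕ) : ℚ) * (k + 1)
            = ((k + z + 1).choose k : ℕ) * (z + 1) := by exact_mod_cast h1
        have h2' : ((z : ℚ) + 1) * (z.choose j : ℕ) = ((z + 1).choose (j + 1) : ℕ) * (j + 1) := by
          exact_mod_cast h2
        push_cast
        linear_combination ((z.choose j : ℕ) : ℚ) * h1' + (((k + z + 1).choose k : ℕ) : ℚ) * h2'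
      · rw [Nat.choose_eq_zero_of_lt (show n < k + 1 by omega), show n - k = 0 by omega]
        simp
  · rw [if_neg h, if_neg (by omega)]
    simp

theorem rankTwos_eq_zero {n k : ℕ} (h : n < k) (i : ℕ) : rankTwos n i k = 0 := by
  simp [rankTwos, Nat.choose_eq_zero_of_lt h]

theorem sum_mul_rankTwos_shift (n i : ℕ) (f : ℕ → ℚ) :
    ∑ k ∈ range (n + 1), (k : ℚ) * f k * rankTwos n (i + 1) k
      = ∑ k ∈ range (n + 1), ((i : ℚ) - 2 * k) * f (k + 1) * rankTwos n i k := by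
  rw [Finset.sum_range_succ']
  have h : ∀ k : ℕ, ((i : ℚ) - 2 * k) * f (k + 1) * rankTwos n i k
      = ((k + 1 : ℕ) : ℚ) * f (k + 1) * rankTwos n (i + 1) (k + 1) := fun k => by
    push_cast
    linear_combination -f (k + 1) * rankTwos_raise_one n i k
  rw [Finset.sum_congr rfl fun k _ => h k, Finset.sum_range_succ _ n,
    rankTwos_eq_zero (Nat.lt_succ_self n)]
  simp

theorem sum_rankTwos_stein {n i : ℕ} (hi : i ≤ n) (f : ℕ → ℚ) :
    ∑ k ∈ range (n + 1), (k : ℚ) * ((n : ℚ) - i + k) * f k * rankTwos n i k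
      = ∑ k ∈ range (n + 1),
          ((i : ℚ) - 2 * k) * ((i : ℚ) - 2 * k - 1) * f (k + 1) * rankTwos n i k := by
  have h := sum_mul_rankTwos_shift n i fun k => ((i : ℚ) + 1 - 2 * k) * f k
  have h1 : ∀ k : ℕ, (k : ℚ) * ((n : ℚ) - i + k) * f k * rankTwos n i k
      = k * (((i : ℚ) + 1 - 2 * k) * f k) * rankTwos n (i + 1) k := fun k => by
    linear_combination -(k * f k) * rankTwos_raise_zero hi k
  rw [Finset.sum_congr rfl fun k _ => h1 k, h]
  refine Finset.sum_congr rfl fun k _ => ?_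
  push_cast
  ring

/-- The total number of coordinates equal to `2` in all points of rank `i`. -/
def sumTwos (n i : ℕ) : ℚ := ∑ k ∈ range (n + 1), (k : ℚ) * rankTwos n i k

theorem ell_cast (n i : ℕ) : (ell n i : ℚ) = ∑ k ∈ range (n + 1), (rankTwos n i k : ℚ) := by
  rw [ell_eq_sum]; push_cast; rfl

theorem sumTwos_succ (n i : ℕ) : sumTwos n (i + 1) = i * ell n i - 2 * sumTwos n i := by
  have h := sum_mul_rankTwos_shift n i fun _ => 1
  simp only [mul_one] at h
  rw [sumTwos, h, ell_cast, sumTwos, Finset.mul_sum, Finset.mul_sum, ← Finset.sum_sub_distrib]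
  exact Finset.sum_congr rfl fun k _ => by ring

theorem succ_mul_ell_succ {n i : ℕ} (hi : i ≤ n) :
    ((i : ℚ) + 1) * ell n (i + 1) = (n + i) * ell n i - 3 * sumTwos n i := by
  have h : ((i : ℚ) + 1) * ell n (i + 1) - 2 * sumTwos n (i + 1)
      = (n - i) * ell n i + sumTwos n i := by
    simp only [ell_cast, sumTwos, Finset.mul_sum]
    rw [← Finset.sum_sub_distrib, ← Finset.sum_add_distrib]
    exact Finset.sum_congr rfl fun k _ => by linear_combination rankTwos_raise_zero hi k
  linear_combination h + 2 * sumTwos_succ n i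

theorem ell_recurrence {n i : ℕ} (hi : i + 1 ≤ n) :
    ((i : ℚ) + 2) * ell n (i + 2) = (n - i - 1) * ell n (i + 1) + (2 * n - i) * ell n i := by
  have h1 := succ_mul_ell_succ hi
  have h2 := succ_mul_ell_succ (show i ≤ n by omega)
  push_cast at h1
  linear_combination h1 - 3 * sumTwos_succ n i + 2 * h2

theorem ell_pos {n i : ℕ} (hi : i ≤ n) : 0 < ell n i := by
  rw [ell_eq_sum]
  refine lt_of_lt_of_le ?_ (Finset.single_le_sum (fun _ _ => Nat.zero_le _)
    (Finset.mem_range.2 (Nat.succ_pos n)))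
  simpa [rankTwos] using Nat.choose_pos hi

theorem ell_zero (n : ℕ) : ell n 0 = 1 := by
  simp [ell_eq_coeff, coeff_zero_eq_eval_zero]

theorem ell_one (n : ℕ) : (ell n 1 : ℚ) = n := by
  have h := succ_mul_ell_succ (Nat.zero_le n)
  have h0 : sumTwos n 0 = 0 := by
    refine Finset.sum_eq_zero fun k _ => ?_
    rcases k with _ | k <;> simp [rankTwos]
  simpa [h0, ell_zero] using h

/-- A lower bound for the variance of the number of twos at rank `i`, combined with the relations
between its first moments. -/
theorem sumTwos_quadratic {n i : ℕ} (hi : i ≤ n) :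
    3 * ((n : ℚ) + 3 * i - 5) * sumTwos n i ^ 2
      - (n + 3 * i - 6) * ell n i * ((n + 3 * i - 2) * sumTwos n i - i * (i - 1) * ell n i)
      + 3 * (n - i) * ell n i * sumTwos n i ≤ 0 := by
  set w : ℕ → ℚ := fun k => rankTwos n i k with hw
  set S0 : ℚ := ((ell n i : ℕ) : ℚ) with hS0
  set S1 : ℚ := sumTwos n i with hS1
  set S2 : ℚ := ∑ k ∈ range (n + 1), (k : ℚ) ^ 2 * w k with hS2
  set S3 : ℚ := ∑ k ∈ range (n + 1), (k : ℚ) ^ 3 * w k with hS3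
  have e0 : ∑ k ∈ range (n + 1), w k = S0 := (ell_cast n i).symm
  have e1 : ∑ k ∈ range (n + 1), (k : ℚ) * w k = S1 := rfl
  have cubic : ∀ a b c d : ℚ,
      ∑ k ∈ range (n + 1), (a + b * k + c * (k : ℚ) ^ 2 + d * (k : ℚ) ^ 3) * w k
        = a * S0 + b * S1 + c * S2 + d * S3 := fun a b c d => by
    rw [← e0, ← e1, hS2, hS3]
    simp only [Finset.mul_sum, ← Finset.sum_add_distrib]
    exact Finset.sum_congr rfl fun k _ => by ring
  have m1 : 3 * S2 = (n + 3 * i - 2) * S1 - i * (i - 1) * S0 := by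
    have h := sum_rankTwos_stein hi fun _ => 1
    have l := cubic 0 (n - i) 1 0
    have r := cubic (i * (i - 1)) (-(4 * i - 2)) 4 0
    have h' : ∑ k ∈ range (n + 1), (0 + ((n : ℚ) - i) * k + 1 * (k : ℚ) ^ 2 + 0 * (k : ℚ) ^ 3) * w k
        = ∑ k ∈ range (n + 1), ((i : ℚ) * (i - 1) + -(4 * (i : ℚ) - 2) * k + 4 * (k : ℚ) ^ 2
          + 0 * (k : ℚ) ^ 3) * w k := by
      convert h using 2 <;> simp only [hw] <;> ring
    linear_combination -h' + l - r
  have m2 : (n + 3 * i - 2) * S2 - i * (i - 1) * S1 - 3 * S3 = S2 + (n - i) * S1 := by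
    have h := sum_rankTwos_stein hi fun k => k
    have l := cubic 0 0 (n - i) 1
    have r := cubic (i * (i - 1)) (i * (i - 1) - (4 * i - 2)) (4 - (4 * i - 2)) 4
    have h' : ∑ k ∈ range (n + 1), (0 + 0 * (k : ℚ) + ((n : ℚ) - i) * (k : ℚ) ^ 2
          + 1 * (k : ℚ) ^ 3) * w k
        = ∑ k ∈ range (n + 1), ((i : ℚ) * (i - 1) + ((i : ℚ) * (i - 1) - (4 * i - 2)) * k
          + (4 - (4 * (i : ℚ) - 2)) * (k : ℚ) ^ 2 + 4 * (k : ℚ) ^ 3) * w k := by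
      convert h using 2 <;> simp only [hw] <;> push_cast <;> ring
    linear_combination h' - l + r + m1
  have key : 0 ≤ ∑ k ∈ range (n + 1), ∑ l ∈ range (n + 1),
      3 * (((k : ℚ) - l) ^ 2 * (k + l - 1)) * (w k * w l) := by
    refine Finset.sum_nonneg fun k _ => Finset.sum_nonneg fun l _ => ?_
    refine mul_nonneg (mul_nonneg (by norm_num) ?_)
      (mul_nonneg (Nat.cast_nonneg _) (Nat.cast_nonneg _))
    rcases Nat.eq_zero_or_pos (k + l) with h | h
    · obtain ⟨rfl, rfl⟩ : k = 0 ∧ l = 0 := by omega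
      simp
    · have : (1 : ℚ) ≤ k + l := by exact_mod_cast h
      exact mul_nonneg (sq_nonneg _) (by linarith)
  have expand : ∑ k ∈ range (n + 1), ∑ l ∈ range (n + 1),
      3 * (((k : ℚ) - l) ^ 2 * (k + l - 1)) * (w k * w l)
      = 6 * (S3 * S0 - S2 * S1 - (S2 * S0 - S1 ^ 2)) := by
    have inner : ∀ k : ℕ, ∑ l ∈ range (n + 1),
        3 * (((k : ℚ) - l) ^ 2 * (k + l - 1)) * (w k * w l)
        = (3 * (S3 - S2) + 3 * (2 * S1 - S2) * k + 3 * (-S0 - S1) * (k : ℚ) ^ 2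
          + 3 * S0 * (k : ℚ) ^ 3) * w k := fun k => by
      have c := cubic (3 * (k ^ 3 - k ^ 2)) (3 * (2 * k - k ^ 2)) (3 * (-1 - k)) 3
      rw [show ∑ l ∈ range (n + 1), 3 * (((k : ℚ) - l) ^ 2 * (k + l - 1)) * (w k * w l)
        = w k * ∑ l ∈ range (n + 1), (3 * ((k : ℚ) ^ 3 - k ^ 2) + 3 * (2 * k - k ^ 2) * l
          + 3 * (-1 - k) * (l : ℚ) ^ 2 + 3 * (l : ℚ) ^ 3) * w l by
        rw [Finset.mul_sum]
        exact Finset.sum_congr rfl fun l _ => by ring, c]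
      ring
    rw [Finset.sum_congr rfl fun k _ => inner k, cubic]
    ring
  rw [expand] at key
  linear_combination (3 / 2) * key + (((n : ℚ) + 3 * i - 6) * S0 - 3 * S1) * m1 - 3 * S0 * m2

theorem le_of_quadratic_nonpos {A B C μ ν : ℚ} (hA : 0 ≤ A) (hμ : A * μ ^ 2 + B * μ + C ≤ 0)
    (hν : 0 ≤ A * ν ^ 2 + B * ν + C) (hd : 2 * A * ν + B < 0) : ν ≤ μ := by
  by_contra! h
  have : 0 < (ν - μ) * (-(2 * A * ν + B) + A * (ν - μ)) :=
    mul_pos (by linarith) (by nlinarith [mul_nonneg hA (sub_pos.2 h).le])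
  nlinarith

theorem ell_succ_le_of_quadratic {n i : ℕ} {ν : ℚ} (hi : 2 ≤ i) (hin : i ≤ n)
    (hν : 0 ≤ 3 * ((n : ℚ) + 3 * i - 5) * ν ^ 2
      - (n + 3 * i - 6) * ((n + 3 * i - 2) * ν - i * (i - 1)) + 3 * (n - i) * ν)
    (hd : 6 * ((n : ℚ) + 3 * i - 5) * ν - (n + 3 * i - 6) * (n + 3 * i - 2) + 3 * (n - i) < 0) :
    ((i : ℚ) + 1) * (ell n (i + 1) / ell n i) ≤ n + i - 3 * ν := by
  have hS : (0 : ℚ) < ell n i := by exact_mod_cast ell_pos hin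
  have h2 : (2 : ℚ) ≤ i := by exact_mod_cast hi
  have hn : (i : ℚ) ≤ n := by exact_mod_cast hin
  have hq := sumTwos_quadratic hin
  obtain ⟨μ, hμ⟩ : ∃ μ : ℚ, sumTwos n i = μ * ell n i :=
    ⟨sumTwos n i / ell n i, (div_mul_cancel₀ _ hS.ne').symm⟩
  rw [hμ] at hq
  have hle : ν ≤ μ := by
    refine le_of_quadratic_nonpos (A := 3 * ((n : ℚ) + 3 * i - 5))
      (B := -(n + 3 * i - 6) * (n + 3 * i - 2) + 3 * (n - i))
      (C := (n + 3 * i - 6) * (i * (i - 1))) (by linarith) ?_ (by linarith) (by linarith)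
    refine nonpos_of_mul_nonpos_left (b := (ell n i : ℚ) ^ 2) ?_ (by positivity)
    linear_combination hq
  have : ((i : ℚ) + 1) * (ell n (i + 1) / ell n i) = n + i - 3 * μ := by
    rw [← mul_div_assoc, succ_mul_ell_succ hin, hμ]
    field_simp
  linarith

theorem ell_ratio_le_even {n m : ℕ} (hn : 2 * m + 3 ≤ n) :
    (ell n (2 * m + 1) : ℚ) / ell n (2 * m) ≤ ((n : ℚ) - m) / (m + 1) := by
  rcases Nat.eq_zero_or_pos m with rfl | hm
  · simp [ell_zero, ell_one]
  obtain ⟨t, rfl⟩ := Nat.exists_eq_add_of_le hn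
  obtain ⟨s, rfl⟩ := Nat.exists_eq_add_of_le hm
  have h := ell_succ_le_of_quadratic (n := 2 * (1 + s) + 3 + t) (i := 2 * (1 + s))
    (ν := (1 + s) * (2 * (1 + s) - t) / (3 * (s + 2))) (by omega) (by omega) ?_ ?_
  · push_cast at h ⊢
    refine le_of_mul_le_mul_left (h.trans (le_of_eq ?_)) (by positivity : (0 : ℚ) < 2 * (1 + s) + 1)
    field_simp
    ring
  · push_cast
    field_simp
    rw [← sub_nonneg]
    ring_nf
    have h1 : (0 : ℚ) ≤ s * (s - 1) * (18 * s + 24) := by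
      rcases Nat.eq_zero_or_pos s with rfl | hs
      · simp
      · have : (1 : ℚ) ≤ s := by exact_mod_cast hs
        exact mul_nonneg (mul_nonneg (by positivity) (by linarith)) (by positivity)
    have h2 : (0 : ℚ) ≤ 16 * s + s * t * 166 + s * t ^ 2 * 63 + s * t ^ 3 * 5 + s ^ 2 * t * 234
        + s ^ 2 * t ^ 2 * 61 + s ^ 2 * t ^ 3 * 2 + s ^ 3 * t * 116 + s ^ 3 * t ^ 2 * 18
        + s ^ 4 * 4 + s ^ 4 * t * 16 + t * 32 + t ^ 2 * 20 + t ^ 3 * 3 := by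
      positivity
    linarith
  · push_cast
    rw [← neg_pos]
    ring_nf
    field_simp
    ring_nf
    positivity

theorem ell_ratio_le_odd {n m : ℕ} (hn : 2 * m + 4 ≤ n) :
    (ell n (2 * m + 2) : ℚ) / ell n (2 * m + 1) ≤ 1 / (m + 1) + ((n : ℚ) - (m + 1)) / (m + 2) := by
  rcases Nat.eq_zero_or_pos m with rfl | hm
  · have h := ell_recurrence (n := n) (i := 0) (by omega)
    have hn0 : (n : ℚ) ≠ 0 := by exact_mod_cast (by omega : n ≠ 0)
    simp only [zero_add, mul_zero, ell_zero, ell_one, Nat.cast_zero, Nat.cast_one] at h ⊢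
    refine le_of_eq ?_
    field_simp
    linear_combination h
  obtain ⟨t, rfl⟩ := Nat.exists_eq_add_of_le hn
  obtain ⟨s, rfl⟩ := Nat.exists_eq_add_of_le hm
  have h := ell_succ_le_of_quadratic (n := 2 * (1 + s) + 4 + t) (i := 2 * (1 + s) + 1)
    (ν := ((4 * s + 7 + t) - 2 * (s + 2) * (s + t + 4) / (s + 3)) / 3) (by omega) (by omega) ?_ ?_
  · push_cast at h ⊢
    refine le_of_mul_le_mul_left (h.trans (le_of_eq ?_))
      (by positivity : (0 : ℚ) < 2 * (1 + s) + 1 + 1)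
    field_simp
    ring
  · push_cast
    field_simp
    ring_nf
    positivity
  · push_cast
    rw [← neg_pos]
    ring_nf
    field_simp
    ring_nf
    positivity

theorem ell_ratio_le_div_of_le {n i : ℕ} (hi : i + 4 ≤ n) :
    (ell n (i + 1) : ℚ) / ell n i ≤ (2 * n - i) / (i + 2) := by
  rcases Nat.even_or_odd' i with ⟨m, rfl | rfl⟩
  · refine (ell_ratio_le_even (by omega)).trans (le_of_eq ?_)
    push_cast
    field_simp
  · refine (ell_ratio_le_odd (by omega)).trans ?_
    obtain ⟨t, rfl⟩ := Nat.exists_eq_add_of_le hi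
    push_cast
    rw [← sub_nonneg]
    have : (2 * (2 * (m : ℚ) + 1 + 4 + t) - (2 * m + 1)) / (2 * m + 1 + 2)
        - (1 / (m + 1) + (2 * m + 1 + 4 + t - (m + 1)) / (m + 2))
        = (m + t * (m + 1)) / ((2 * m + 3) * (m + 1) * (m + 2)) := by
      field_simp
      ring
    rw [this]
    positivity

theorem le_ell_ratio {n i : ℕ} (hi : i + 4 ≤ n) :
    ((n : ℚ) + 1) / (i + 2) ≤ ell n (i + 2) / ell n (i + 1) := by
  have h0 : (0 : ℚ) < ell n i := by exact_mod_cast ell_pos (show i ≤ n by omega)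
  have h1 : (0 : ℚ) < ell n (i + 1) := by exact_mod_cast ell_pos (show i + 1 ≤ n by omega)
  have h := ell_ratio_le_div_of_le hi
  rw [div_le_div_iff₀ h0 (by positivity)] at h
  rw [div_le_div_iff₀ (by positivity) h1]
  linear_combination h - ell_recurrence (n := n) (i := i) (by omega)

end

/-- For `n ≥ 4` and `1 ≤ i ≤ n-3`,
`(n+1)/(i+1) ≤ ℓ_{i+1}(n)/ℓ_i(n) ≤ (⌈i/2⌉ - ⌊i/2⌋)/⌈i/2⌉ + (n - ⌈i/2⌉)/⌈(i+2)/2⌉`.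
Here `⌈i/2⌉ = (i+1)/2`, `⌊i/2⌋ = i/2` and `⌈(i+2)/2⌉ = (i+3)/2` in natural division. -/
theorem ell_ratio_bounds (n i : ℕ) (hn : 4 ≤ n) (hi1 : 1 ≤ i) (hi2 : i ≤ n - 3) :
    ((n : ℚ) + 1) / ((i : ℚ) + 1) ≤ (ell n (i + 1) : ℚ) / (ell n i : ℚ) ∧
    (ell n (i + 1) : ℚ) / (ell n i : ℚ) ≤
      (((i + 1) / 2 - i / 2 : ℕ) : ℚ) / (((i + 1) / 2 : ℕ) : ℚ)
        + ((n - (i + 1) / 2 : ℕ) : ℚ) / (((i + 3) / 2 : ℕ) : ℚ) := by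
  constructor
  · obtain ⟨i, rfl⟩ := Nat.exists_eq_add_of_le' hi1
    convert le_ell_ratio (n := n) (i := i) (by omega) using 2
    push_cast
    ring
  · rcases Nat.even_or_odd' i with ⟨m, rfl | rfl⟩
    · convert ell_ratio_le_even (n := n) (m := m) (by omega) using 1
      rw [show (2 * m + 1) / 2 = m by omega, show 2 * m / 2 = m by omega,
        show (2 * m + 3) / 2 = m + 1 by omega, Nat.cast_sub (show m ≤ n by omega)]
      simp
    · convert ell_ratio_le_odd (n := n) (m := m) (by omega) using 1
      rw [show (2 * m + 1 + 1) / 2 = m + 1 by omega, show (2 * m + 1) / 2 = m by omega,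
        show (2 * m + 1 + 3) / 2 = m + 2 by omega, Nat.cast_sub (show m + 1 ≤ n by omega),
        Nat.add_sub_cancel_left]
      push_cast
      ring
end

section
/- For all integers n ≥ 5, we have (⌈(n−1)/2⌉ − ⌊(n−1)/2⌋)/⌈(n−1)/2⌉ + ⌊(n+1)/2⌋/⌈(n+1)/2⌉ ≤ ℓ_n(n)/ℓ_{n−1}(n) ≤ (n+1)/n, where the bounds are rational numbers. -/
open Polynomial in
/-- `ell n i` is the trinomial coefficient `[X ^ i] (1 + X + X ^ 2) ^ n`. -/
theorem coeff_trinomial_pow (n i : ℕ) : ((1 + X + X ^ 2 : ℤ[X]) ^ n).coeff i = ell n i := by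
  have h : (1 + X + X ^ 2 : ℤ[X]) = ∑ a : Fin 3, X ^ (a : ℕ) := by
    simp [Fin.sum_univ_three]
  rw [h, Fintype.sum_pow, finsetSum_coeff, ell, Nat.card_eq_fintype_card, Fintype.card_subtype]
  simp [Finset.prod_pow_eq_pow_sum, coeff_X_pow, eq_comm]

open Polynomial in
theorem ell_succ (n i : ℕ) : ell (n + 1) (i + 2) = ell n (i + 2) + ell n (i + 1) + ell n i := by
  zify
  simp only [← coeff_trinomial_pow]
  rw [pow_succ', add_mul, add_mul, coeff_add, coeff_add, one_mul, coeff_X_mul, coeff_X_pow_mul]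

open Polynomial in
/-- Comparison of coefficients in `P * (P ^ n)' = n * P' * P ^ n` for `P = 1 + X + X ^ 2`. -/
theorem ell_three_term (n i : ℕ) :
    (i + 2) * ell n (i + 2) + (i + 1) * ell n (i + 1) + i * ell n i =
      n * (ell n (i + 1) + 2 * ell n i) := by
  zify
  simp only [← coeff_trinomial_pow]
  set P : ℤ[X] := 1 + X + X ^ 2 with hP
  have hd : derivative P = 1 + 2 * X := by
    simp [hP]
  have h : derivative (P ^ n) + X * derivative (P ^ n) + X * (X * derivative (P ^ n)) =
      C (n : ℤ) * (P ^ n + C 2 * (X * P ^ n)) := by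
    cases n with
    | zero => simp
    | succ n =>
      rw [derivative_pow_succ, hd]
      simp only [map_add, map_natCast, map_one, map_ofNat, Nat.cast_add, Nat.cast_one]
      rw [hP]
      ring
  have hX : (X * derivative (P ^ n)).coeff i = i * (P ^ n).coeff i := by
    cases i with
    | zero => simp
    | succ i => rw [coeff_X_mul, coeff_derivative]; push_cast; ring
  have := congrArg (fun q => coeff q (i + 1)) h
  simp only [coeff_add, coeff_C_mul, coeff_X_mul, hX, coeff_derivative] at this
  push_cast at this
  linear_combination this

theorem ell_central_symm (n : ℕ) : ell (n + 1) (n + 2) = ell (n + 1) n := by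
  have h := ell_three_term (n + 1) n
  have : (n + 2) * ell (n + 1) (n + 2) = (n + 2) * ell (n + 1) n := by linarith
  exact Nat.eq_of_mul_eq_mul_left (by omega) this

theorem ell_central_succ (n : ℕ) :
    ell (n + 2) (n + 2) = ell (n + 1) (n + 1) + 2 * ell (n + 1) n := by
  rw [ell_succ, ell_central_symm]
  ring

theorem ell_subcentral_succ (n : ℕ) :
    (n + 4) * ell (n + 3) (n + 2) =
      (n + 3) * (ell (n + 2) (n + 1) + 2 * ell (n + 2) (n + 2)) := by
  have h := ell_three_term (n + 2) n
  rw [ell_succ]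
  linarith

theorem ell_central_bounds (n : ℕ) :
    0 < ell (n + 2) (n + 1) ∧ ell (n + 2) (n + 1) ≤ ell (n + 2) (n + 2) ∧
      (n + 2) * ell (n + 2) (n + 2) ≤ (n + 3) * ell (n + 2) (n + 1) := by
  induction n with
  | zero =>
    have h1 : ell 2 1 = 2 := by rw [ell, Nat.card_eq_fintype_card]; decide
    have h2 : ell 2 2 = 3 := by rw [ell, Nat.card_eq_fintype_card]; decide
    simp [h1, h2]
  | succ n ih =>
    obtain ⟨h0, h1, h2⟩ := ih
    have hT := ell_central_succ (n + 1)
    have hU := ell_subcentral_succ n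
    simp only [add_assoc, Nat.reduceAdd] at *
    refine ⟨?_, ?_, ?_⟩
    · refine Nat.pos_of_mul_pos_left (a := n + 4) ?_
      rw [hU]
      positivity
    · refine le_of_mul_le_mul_left (a := n + 4) ?_ (by omega)
      nlinarith
    · nlinarith

/-- For `n ≥ 5`,
`(⌈(n-1)/2⌉ - ⌊(n-1)/2⌋)/⌈(n-1)/2⌉ + ⌊(n+1)/2⌋/⌈(n+1)/2⌉ ≤ ℓ_n(n)/ℓ_{n-1}(n) ≤ (n+1)/n`.
Here `⌈(n-1)/2⌉ = n/2`, `⌊(n-1)/2⌋ = (n-1)/2`, `⌊(n+1)/2⌋ = (n+1)/2` and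
`⌈(n+1)/2⌉ = (n+2)/2` in natural division. -/
theorem ell_ratio_nsub1 (n : ℕ) (hn : 5 ≤ n) :
    ((n / 2 - (n - 1) / 2 : ℕ) : ℚ) / ((n / 2 : ℕ) : ℚ)
        + (((n + 1) / 2 : ℕ) : ℚ) / (((n + 2) / 2 : ℕ) : ℚ) ≤
      (ell n n : ℚ) / (ell n (n - 1) : ℚ) ∧
    (ell n n : ℚ) / (ell n (n - 1) : ℚ) ≤ ((n : ℚ) + 1) / (n : ℚ) := by
  obtain ⟨k, rfl⟩ : ∃ k, n = k + 5 := ⟨n - 5, by omega⟩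
  have hT := ell_central_succ (k + 3)
  have hU := ell_subcentral_succ (k + 2)
  obtain ⟨-, -, h⟩ := ell_central_bounds (k + 2)
  obtain ⟨hpos, hle, hup⟩ := ell_central_bounds (k + 3)
  simp only [add_assoc, Nat.reduceAdd] at hT hU h hpos hle hup
  rw [show k + 5 - 1 = k + 4 by omega]
  have hpos' : (0 : ℚ) < ell (k + 5) (k + 4) := by exact_mod_cast hpos
  constructor
  · rcases Nat.even_or_odd' k with ⟨j, rfl | rfl⟩
    · rw [show (2 * j + 5) / 2 = j + 2 by omega, show (2 * j + 4) / 2 = j + 2 by omega,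
        show (2 * j + 5 + 1) / 2 = j + 3 by omega, show (2 * j + 5 + 2) / 2 = j + 3 by omega,
        Nat.sub_self, Nat.cast_zero, zero_div, zero_add, div_self (by positivity),
        one_le_div hpos']
      exact_mod_cast hle
    · rw [show (2 * j + 1 + 5) / 2 = j + 3 by omega, show (2 * j + 1 + 4) / 2 = j + 2 by omega,
        show (2 * j + 1 + 5 + 1) / 2 = j + 3 by omega,
        show (2 * j + 1 + 5 + 2) / 2 = j + 4 by omega, show j + 3 - (j + 2) = 1 by omega,
        div_add_div _ _ (by positivity) (by positivity), div_le_div_iff₀ (by positivity) hpos']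
      norm_cast
      refine le_of_mul_le_mul_left (a := 2 * j + 7) ?_ (by omega)
      rw [hT]
      generalize ell (2 * j + 1 + 4) (2 * j + 1 + 4) = T at *
      generalize ell (2 * j + 1 + 4) (2 * j + 1 + 3) = U at *
      generalize ell (2 * j + 1 + 5) (2 * j + 1 + 4) = U' at *
      have key : (2 * j ^ 2 + 13 * j + 24) * T ≤ (2 * j ^ 2 + 16 * j + 30) * U := by
        refine le_of_mul_le_mul_left (a := 2 * j + 5) ?_ (by omega)
        nlinarith [Nat.mul_le_mul_left (2 * j ^ 2 + 13 * j + 24) h, Nat.zero_le (j * U)]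
      calc (2 * j + 7) * ((1 * (j + 4) + (j + 3) * (j + 3)) * U')
          = (1 * (j + 4) + (j + 3) * (j + 3)) * ((2 * j + 1 + 6) * U') := by ring
        _ ≤ _ := by
          rw [hU]
          nlinarith [Nat.mul_le_mul_left (j + 3) key]
  · rw [div_le_div_iff₀ hpos' (by positivity), mul_comm]
    exact_mod_cast hup
end
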